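/- Perturbed strong convexity: let h : ℝ^d → ℝ be differentiable with β-Lipschitz gradient and μ-strongly convex with μ ≥ 0. Then for all x, y, z ∈ ℝ^d: ⟨∇h(x), z − y⟩ ≥ h(z) − h(y) + (μ/4)·‖y − z‖² − β·‖z − x‖². -/

import Mathlib

open MeasureTheory
open scoped RealInnerProductSpace

noncomputable section

section FirstOrder

variable {E : Type*} [NormedAddCommGroup E]

/-- A convex function lies above its tangent planes. -/
lemma ConvexOn.add_fderiv_le_of_univ [NormedSpace ℝ E] {f : E → ℝ} {f' : E →L[ℝ] ℝ} {x : E}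
    (hf : ConvexOn ℝ Set.univ f) (hx : HasFDerivAt f f' x) (y : E) :
    f x + f' (y - x) ≤ f y := by
  have hconv : ConvexOn ℝ Set.univ (f ∘ AffineMap.lineMap (k := ℝ) x y) :=
    hf.comp_affineMap _
  have hderiv : HasDerivAt (f ∘ AffineMap.lineMap (k := ℝ) x y) (f' (y - x)) 0 := by
    refine HasFDerivAt.comp_hasDerivAt 0 ?_ AffineMap.hasDerivAt_lineMap
    simpa using hx
  have := hconv.le_slope_of_hasDerivAt (Set.mem_univ 0) (Set.mem_univ 1) one_pos hderiv
  simp only [slope_def_field, Function.comp_apply, AffineMap.lineMap_apply_one,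
    AffineMap.lineMap_apply_zero, sub_zero, div_one] at this
  linarith

variable [InnerProductSpace ℝ E] [CompleteSpace E] {h : E → ℝ}

/-- The quadratic lower bound for strongly convex functions. -/
lemma StrongConvexOn.add_inner_gradient_add_sq_le {m : ℝ} {x : E}
    (hsc : StrongConvexOn Set.univ m h) (hx : DifferentiableAt ℝ h x) (y : E) :
    h x + ⟪gradient h x, y - x⟫ + m / 2 * ‖y - x‖ ^ 2 ≤ h y := by
  have hderiv := hx.hasGradientAt.hasFDerivAt.sub
    ((hasStrictFDerivAt_norm_sq x).hasFDerivAt.const_mul (m / 2))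
  have := (strongConvexOn_iff_convex.1 hsc).add_fderiv_le_of_univ hderiv y
  simp [inner_sub_right, -toDual_gradient,
    -inner_gradient_left] at this
  rw [inner_sub_right, norm_sub_sq_real, real_inner_comm x y]
  linarith

/-- The descent lemma: the quadratic upper bound for functions with Lipschitz gradient. -/
lemma le_add_inner_gradient_add_sq {β : ℝ} (hdiff : Differentiable ℝ h)
    (hsmooth : ∀ x y, ‖gradient h x - gradient h y‖ ≤ β * ‖x - y‖) (x y : E) :
    h y ≤ h x + ⟪gradient h x, y - x⟫ + β / 2 * ‖y - x‖ ^ 2 := by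
  let φ : ℝ → ℝ := fun t =>
    h (AffineMap.lineMap x y t) - t * ⟪gradient h x, y - x⟫ - β / 2 * ‖y - x‖ ^ 2 * t ^ 2
  have hφ (t : ℝ) : HasDerivAt φ (⟪gradient h (AffineMap.lineMap x y t), y - x⟫ -
      ⟪gradient h x, y - x⟫ - β * ‖y - x‖ ^ 2 * t) t := by
    have hline : HasDerivAt (fun t : ℝ => h (AffineMap.lineMap x y t))
        ⟪gradient h (AffineMap.lineMap x y t), y - x⟫ t :=
      (hdiff _).hasGradientAt.hasFDerivAt.comp_hasDerivAt t AffineMap.hasDerivAt_lineMap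
    refine ((hline.sub ((hasDerivAt_id t).mul_const ⟪gradient h x, y - x⟫)).sub
      ((hasDerivAt_pow 2 t).const_mul (β / 2 * ‖y - x‖ ^ 2))).congr_deriv ?_
    norm_num
    ring
  have hanti : AntitoneOn φ (Set.Icc 0 1) := by
    refine antitoneOn_of_deriv_nonpos (convex_Icc 0 1)
      (fun t _ => (hφ t).continuousAt.continuousWithinAt)
      (fun t _ => (hφ t).differentiableAt.differentiableWithinAt) fun t ht => ?_
    rw [interior_Icc] at ht
    have hgrad : ‖gradient h (AffineMap.lineMap x y t) - gradient h x‖ ≤ β * (t * ‖y - x‖) := by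
      refine (hsmooth _ _).trans_eq ?_
      rw [AffineMap.lineMap_apply_module', add_sub_cancel_right, norm_smul,
        Real.norm_of_nonneg ht.1.le]
    rw [(hφ t).deriv, ← inner_sub_left]
    have := (real_inner_le_norm (gradient h (AffineMap.lineMap x y t) - gradient h x) (y - x)).trans
      (mul_le_mul_of_nonneg_right hgrad (norm_nonneg _))
    linarith
  have := hanti (Set.left_mem_Icc.2 zero_le_one) (Set.right_mem_Icc.2 zero_le_one) zero_le_one
  simp only [φ, AffineMap.lineMap_apply_one, AffineMap.lineMap_apply_zero] at this
  linarith

end FirstOrder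

/-- perturbed strong convexity: for a `β`-smooth, `μ`-strongly convex
function `h`, `⟨∇h(x), z − y⟩ ≥ h(z) − h(y) + (μ/4)‖y − z‖² − β‖z − x‖²`. -/
theorem perturbed_strong_convexity {d : ℕ}
    (h : EuclideanSpace ℝ (Fin d) → ℝ) (hdiff : Differentiable ℝ h)
    (β μ' : ℝ) (hβ : 0 ≤ β) (hμ : 0 ≤ μ')
    (hsmooth : ∀ x y : EuclideanSpace ℝ (Fin d),
      ‖gradient h x - gradient h y‖ ≤ β * ‖x - y‖)
    (hsc : ConvexOn ℝ Set.univ (fun x : EuclideanSpace ℝ (Fin d) =>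
      h x - μ' / 2 * ‖x‖ ^ 2)) :
    ∀ x y z : EuclideanSpace ℝ (Fin d),
      ⟪gradient h x, z - y⟫
        ≥ h z - h y + μ' / 4 * ‖y - z‖ ^ 2 - β * ‖z - x‖ ^ 2 := by
  intro x y z
  have hsc' : StrongConvexOn Set.univ μ' h := strongConvexOn_iff_convex.2 hsc
  have lower_y := hsc'.add_inner_gradient_add_sq_le (hdiff x) y
  have lower_z := hsc'.add_inner_gradient_add_sq_le (hdiff x) z
  have upper_z := le_add_inner_gradient_add_sq hdiff hsmooth x z
  have hsplit : ⟪gradient h x, z - y⟫ = ⟪gradient h x, z - x⟫ - ⟪gradient h x, y - x⟫ := by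
    rw [← inner_sub_right, sub_sub_sub_cancel_right]
  have hsq : ‖y - z‖ ^ 2 ≤ 2 * (‖y - x‖ ^ 2 + ‖z - x‖ ^ 2) := by
    have := parallelogram_law_with_norm ℝ (y - x) (z - x)
    rw [sub_sub_sub_cancel_right] at this
    nlinarith [mul_self_nonneg ‖y - x + (z - x)‖]
  have := mul_le_mul_of_nonneg_left hsq hμ
  linarith

end
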